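/- Let H = (X,Y,E) be a complete bipartite r-uniform hypergraph with |X| = |Y| = r and r ≥ 2, in which every vertex has the same degree δ (the degree of a vertex is the number of hyperedges containing it). Then the total edge-domatic number of H equals δ, i.e., ed_t(H) = δ. -/

import Mathlib

open Finset

/-- Two vertices of a hypergraph with edge set `E` are adjacent if they are distinct
and some hyperedge contains both of them. -/
def HypVAdj {V : Type*} (E : Finset (Finset V)) (x y : V) : Prop :=
  x ≠ y ∧ ∃ e ∈ E, x ∈ e ∧ y ∈ e

/-- A dominating set: every vertex outside `D` is adjacent to some vertex of `D`. -/
def IsDominatingSet {V : Type*} (E : Finset (Finset V)) (D : Finset V) : Prop :=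
  ∀ x : V, x ∉ D → ∃ y ∈ D, HypVAdj E x y

/-- A total dominating set: every vertex is adjacent to some vertex of `D`. -/
def IsTotalDominatingSet {V : Type*} (E : Finset (Finset V)) (D : Finset V) : Prop :=
  ∀ x : V, ∃ y ∈ D, HypVAdj E x y

/-- A partition of the full vertex set into `k` dominating sets. -/
def IsDomaticPartition {V : Type*} [Fintype V] [DecidableEq V] (E : Finset (Finset V))
    {k : ℕ} (C : Fin k → Finset V) : Prop :=
  (∀ i j : Fin k, i ≠ j → Disjoint (C i) (C j)) ∧
  (Finset.univ.biUnion C = Finset.univ) ∧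
  (∀ i, IsDominatingSet E (C i))

/-- A partition of the full vertex set into `k` total dominating sets. -/
def IsTotalDomaticPartition {V : Type*} [Fintype V] [DecidableEq V] (E : Finset (Finset V))
    {k : ℕ} (C : Fin k → Finset V) : Prop :=
  (∀ i j : Fin k, i ≠ j → Disjoint (C i) (C j)) ∧
  (Finset.univ.biUnion C = Finset.univ) ∧
  (∀ i, IsTotalDominatingSet E (C i))

/-- Two hyperedges are adjacent if they are distinct and share at least one vertex. -/
def HypEAdj {V : Type*} [DecidableEq V] (e f : Finset V) : Prop :=
  e ≠ f ∧ (e ∩ f).Nonempty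

/-- An edge-dominating set: a subset `F ⊆ E` such that every hyperedge not in `F`
is adjacent to some hyperedge of `F`. -/
def IsEdgeDominatingSet {V : Type*} [DecidableEq V] (E F : Finset (Finset V)) : Prop :=
  F ⊆ E ∧ ∀ e ∈ E, e ∉ F → ∃ f ∈ F, HypEAdj e f

/-- A total edge-dominating set: a subset `F ⊆ E` such that every hyperedge of `E`
is adjacent to some hyperedge of `F`. -/
def IsTotalEdgeDominatingSet {V : Type*} [DecidableEq V] (E F : Finset (Finset V)) : Prop :=
  F ⊆ E ∧ ∀ e ∈ E, ∃ f ∈ F, HypEAdj e f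

/-- A partition of the edge set `E` into `k` edge-dominating sets. -/
def IsEdgeDomaticPartition {V : Type*} [DecidableEq V] (E : Finset (Finset V))
    {k : ℕ} (C : Fin k → Finset (Finset V)) : Prop :=
  (∀ i j : Fin k, i ≠ j → Disjoint (C i) (C j)) ∧
  (Finset.univ.biUnion C = E) ∧
  (∀ i, IsEdgeDominatingSet E (C i))

/-- A partition of the edge set `E` into `k` total edge-dominating sets. -/
def IsTotalEdgeDomaticPartition {V : Type*} [DecidableEq V] (E : Finset (Finset V))
    {k : ℕ} (C : Fin k → Finset (Finset V)) : Prop :=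
  (∀ i j : Fin k, i ≠ j → Disjoint (C i) (C j)) ∧
  (Finset.univ.biUnion C = E) ∧
  (∀ i, IsTotalEdgeDominatingSet E (C i))

/-- Edge set of the complete `r`-uniform hypergraph on the vertex type `V`:
all `r`-element subsets of `V`. -/
def completeEdges (V : Type*) [Fintype V] [DecidableEq V] (r : ℕ) : Finset (Finset V) :=
  Finset.powersetCard r (Finset.univ : Finset V)

/-- Edge set of the complete bipartite `r`-uniform hypergraph with parts `X` and `Y`:
all `r`-element subsets of `X ∪ Y` meeting both `X` and `Y`. -/
def bipEdges {V : Type*} [DecidableEq V] (X Y : Finset V) (r : ℕ) : Finset (Finset V) :=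
  (Finset.powersetCard r (X ∪ Y)).filter fun e => (e ∩ X).Nonempty ∧ (e ∩ Y).Nonempty

lemma compl_mem_bipEdges {V : Type*} [Fintype V] [DecidableEq V] {X Y : Finset V} {r : ℕ}
    (hdisj : Disjoint X Y) (hunion : X ∪ Y = univ) (hXr : X.card = r) (hYr : Y.card = r)
    {e : Finset V} (he : e ∈ bipEdges X Y r) : eᶜ ∈ bipEdges X Y r := by
  have meets_compl : ∀ {A B : Finset V}, Disjoint A B → A.card = r → e.card = r →
      (e ∩ B).Nonempty → (eᶜ ∩ A).Nonempty := by
    rintro A B hAB hA hcard ⟨b, hb⟩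
    by_contra hne
    have hsub : A ⊆ e := fun a ha ↦ by
      by_contra hae
      exact hne ⟨a, by simp [hae, ha]⟩
    have hAe : A = e := eq_of_subset_of_card_le hsub (by lia)
    rw [mem_inter, ← hAe] at hb
    exact disjoint_left.mp hAB hb.1 hb.2
  simp only [bipEdges, hunion, mem_filter, mem_powersetCard, subset_univ, true_and] at he ⊢
  obtain ⟨hcard, heX, heY⟩ := he
  have htotal : Fintype.card V = 2 * r := by
    rw [← card_univ, ← hunion, card_union_of_disjoint hdisj]
    lia
  refine ⟨?_, meets_compl hdisj hXr hcard heY, meets_compl hdisj.symm hYr hcard heX⟩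
  rw [card_compl]
  lia

/-- An edge is adjacent to every edge other than itself and its complement. -/
lemma hypEAdj_of_mem_bipEdges {V : Type*} [Fintype V] [DecidableEq V] {X Y : Finset V} {r : ℕ}
    (hdisj : Disjoint X Y) (hunion : X ∪ Y = univ) (hXr : X.card = r) (hYr : Y.card = r)
    {e f : Finset V} (he : e ∈ bipEdges X Y r) (hf : f ∈ bipEdges X Y r)
    (hne : e ≠ f) (hnc : e ≠ fᶜ) : HypEAdj e f := by
  refine ⟨hne, ?_⟩
  by_contra hempty
  have hfc := compl_mem_bipEdges hdisj hunion hXr hYr hf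
  simp only [bipEdges, mem_filter, mem_powersetCard] at he hfc
  refine hnc (eq_of_subset_of_card_le (fun a ha ↦ ?_) (by lia))
  rw [mem_compl]
  exact fun haf ↦ hempty ⟨a, mem_inter.mpr ⟨ha, haf⟩⟩

/-- Complementation pairs the edges through a vertex with those avoiding it. -/
lemma card_bipEdges_eq_two_mul {V : Type*} [Fintype V] [DecidableEq V] {X Y : Finset V} {r : ℕ}
    (hdisj : Disjoint X Y) (hunion : X ∪ Y = univ) (hXr : X.card = r) (hYr : Y.card = r)
    (v : V) : (bipEdges X Y r).card = 2 * ((bipEdges X Y r).filter fun e => v ∈ e).card := by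
  have hcompl : ((bipEdges X Y r).filter fun e => v ∉ e).card =
      ((bipEdges X Y r).filter fun e => v ∈ e).card := by
    refine card_bij' (fun e _ ↦ eᶜ) (fun e _ ↦ eᶜ) ?_ ?_ ?_ ?_
    · intro e he
      rw [mem_filter] at he ⊢
      exact ⟨compl_mem_bipEdges hdisj hunion hXr hYr he.1, mem_compl.mpr he.2⟩
    · intro e he
      rw [mem_filter] at he ⊢
      exact ⟨compl_mem_bipEdges hdisj hunion hXr hYr he.1, by simpa using he.2⟩
    · simp
    · simp
  rw [← card_filter_add_card_filter_not (s := bipEdges X Y r) (fun e ↦ v ∈ e), hcompl, two_mul]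

lemma le_card_bipEdges_filter_mem {V : Type*} [DecidableEq V] {X Y : Finset V} {r : ℕ}
    (hdisj : Disjoint X Y) (hXr : X.card = r) (hYr : Y.card = r) (hr2 : 2 ≤ r)
    {x : V} (hx : x ∈ X) : r ≤ ((bipEdges X Y r).filter fun e => x ∈ e).card := by
  obtain ⟨x', hx', hne⟩ := exists_mem_ne (by lia : 1 < X.card) x
  have hYX : ∀ y ∈ Y, y ∉ X.erase x' := fun y hy h ↦
    disjoint_left.mp hdisj (mem_of_mem_erase h) hy
  have hxe : x ∈ X.erase x' := mem_erase.mpr ⟨hne.symm, hx⟩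
  nth_rw 1 [← hYr]
  refine card_le_card_of_injOn (fun y ↦ insert y (X.erase x')) (fun y hy ↦ ?_) ?_
  · have hy : y ∈ Y := hy
    simp only [bipEdges, coe_filter, Set.mem_ofPred_eq, mem_filter, mem_powersetCard]
    refine ⟨⟨⟨?_, ?_⟩, ⟨x, ?_⟩, ⟨y, ?_⟩⟩, mem_insert_of_mem hxe⟩
    · exact insert_subset (mem_union_right _ hy)
        ((erase_subset _ _).trans subset_union_left)
    · rw [card_insert_of_notMem (hYX y hy), card_erase_of_mem hx']
      lia
    · exact mem_inter.mpr ⟨mem_insert_of_mem hxe, hx⟩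
    · exact mem_inter.mpr ⟨mem_insert_self _ _, hy⟩
  · intro y hy z hz hyz
    have hmem : y ∈ insert z (X.erase x') := by
      have hyz : insert y (X.erase x') = insert z (X.erase x') := hyz
      exact hyz ▸ mem_insert_self _ _
    exact (mem_insert.mp hmem).resolve_right (hYX y hy)

lemma two_le_card_of_isTotalEdgeDominatingSet {V : Type*} [DecidableEq V]
    {E F : Finset (Finset V)} (hE : E.Nonempty) (hF : IsTotalEdgeDominatingSet E F) :
    2 ≤ F.card := by
  obtain ⟨e, he⟩ := hE
  obtain ⟨f, hf, -⟩ := hF.2 e he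
  obtain ⟨g, hg, hfg, -⟩ := hF.2 f (hF.1 hf)
  exact one_lt_card.mpr ⟨f, hf, g, hg, hfg⟩

lemma two_mul_le_card_of_isTotalEdgeDomaticPartition {V : Type*} [DecidableEq V]
    {E : Finset (Finset V)} {k : ℕ} {C : Fin k → Finset (Finset V)} (hE : E.Nonempty)
    (hC : IsTotalEdgeDomaticPartition E C) : 2 * k ≤ E.card := by
  obtain ⟨hpair, hcover, hdom⟩ := hC
  rw [← hcover, card_biUnion fun i _ j _ hij ↦ hpair i j hij]
  calc 2 * k = ∑ _i : Fin k, 2 := by simp [mul_comm]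
    _ ≤ ∑ i : Fin k, (C i).card :=
      sum_le_sum fun i _ ↦ two_le_card_of_isTotalEdgeDominatingSet hE (hdom i)

/-- Given the edges `e₀, …, e_{m+1}` through `v`, the classes `{eᵢ, eᵢ₊₁ᶜ}`, with indices taken
cyclically, partition the edge set into total edge-dominating sets. -/
lemma exists_isTotalEdgeDomaticPartition_bipEdges {V : Type*} [Fintype V] [DecidableEq V]
    {X Y : Finset V} {r m : ℕ}
    (hdisj : Disjoint X Y) (hunion : X ∪ Y = univ) (hXr : X.card = r) (hYr : Y.card = r)
    (v : V) (hv : ((bipEdges X Y r).filter fun e => v ∈ e).card = m + 2) :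
    ∃ C : Fin (m + 2) → Finset (Finset V), IsTotalEdgeDomaticPartition (bipEdges X Y r) C := by
  let φ := (equivFinOfCardEq hv).symm
  let g : Fin (m + 2) → Finset V := fun i ↦ (φ i).1
  have hgE : ∀ i, g i ∈ bipEdges X Y r := fun i ↦ (mem_filter.mp (φ i).2).1
  have hgv : ∀ i, v ∈ g i := fun i ↦ (mem_filter.mp (φ i).2).2
  have hginj : ∀ {i j}, g i = g j → i = j := fun h ↦ φ.injective (Subtype.ext h)
  have hgsurj : ∀ e ∈ bipEdges X Y r, v ∈ e → ∃ i, g i = e := fun e he hve ↦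
    ⟨φ.symm ⟨e, mem_filter.mpr ⟨he, hve⟩⟩, by simp [g]⟩
  have hgc : ∀ i j, g i ≠ (g j)ᶜ := fun i j h ↦ by
    have := hgv i
    rw [h, mem_compl] at this
    exact this (hgv j)
  have hcE : ∀ {e}, e ∈ bipEdges X Y r → eᶜ ∈ bipEdges X Y r :=
    compl_mem_bipEdges hdisj hunion hXr hYr
  refine ⟨fun i ↦ {g i, (g (i + 1))ᶜ}, ?_, ?_, fun i ↦ ⟨?_, fun e he ↦ ?_⟩⟩
  · intro i j hij
    rw [disjoint_left]
    intro e hei hej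
    simp only [mem_insert, mem_singleton] at hei hej
    rcases hei with rfl | rfl <;> rcases hej with h | h
    · exact hij (hginj h)
    · exact hgc _ _ h
    · exact hgc _ _ h.symm
    · exact hij (add_right_cancel (hginj (compl_injective h)))
  · ext e
    simp only [mem_biUnion, mem_univ, true_and, mem_insert, mem_singleton]
    constructor
    · rintro ⟨i, rfl | rfl⟩
      · exact hgE i
      · exact hcE (hgE _)
    · intro he
      by_cases hve : v ∈ e
      · obtain ⟨i, hi⟩ := hgsurj e he hve
        exact ⟨i, Or.inl hi.symm⟩
      · obtain ⟨i, hi⟩ := hgsurj eᶜ (hcE he) (mem_compl.mpr hve)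
        exact ⟨i - 1, Or.inr (by rw [sub_add_cancel, hi, compl_compl])⟩
  · intro e he
    simp only [mem_insert, mem_singleton] at he
    rcases he with rfl | rfl
    · exact hgE i
    · exact hcE (hgE _)
  · have hne : g i ≠ g (i + 1) := fun h ↦ by simpa using hginj h
    by_cases h : e = g i ∨ e = (g i)ᶜ
    · refine ⟨(g (i + 1))ᶜ, by simp,
        hypEAdj_of_mem_bipEdges hdisj hunion hXr hYr he (hcE (hgE _)) ?_ ?_⟩
      · rcases h with rfl | rfl
        · exact hgc _ _
        · exact fun h ↦ hne (compl_injective h)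
      · rw [compl_compl]
        rcases h with rfl | rfl
        · exact hne
        · exact fun h ↦ hgc _ _ h.symm
    · push Not at h
      exact ⟨g i, by simp, hypEAdj_of_mem_bipEdges hdisj hunion hXr hYr he (hgE i) h.1 h.2⟩

/-- a complete bipartite `r`-uniform hypergraph with `|X| = |Y| = r`,
`r ≥ 2`, in which every vertex has degree `δ`, has total edge-domatic number `δ`. -/
theorem total_edge_domatic_number_bipartite_degree {V : Type*} [Fintype V] [DecidableEq V]
    {X Y : Finset V} {r δ : ℕ}
    (hdisj : Disjoint X Y) (hX : X.Nonempty) (hY : Y.Nonempty)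
    (hunion : X ∪ Y = (Finset.univ : Finset V))
    (hXr : X.card = r) (hYr : Y.card = r) (hr2 : 2 ≤ r)
    (hdeg : ∀ v : V, ((bipEdges X Y r).filter fun e => v ∈ e).card = δ) :
    IsGreatest {k : ℕ | ∃ C : Fin k → Finset (Finset V),
      IsTotalEdgeDomaticPartition (bipEdges X Y r) C} δ := by
  obtain ⟨x, hx⟩ := hX
  have hδ : 2 ≤ δ := hr2.trans (hdeg x ▸ le_card_bipEdges_filter_mem hdisj hXr hYr hr2 hx)
  have hcard : (bipEdges X Y r).card = 2 * δ :=
    hdeg x ▸ card_bipEdges_eq_two_mul hdisj hunion hXr hYr x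
  constructor
  · obtain ⟨m, rfl⟩ := Nat.exists_eq_add_of_le' hδ
    exact exists_isTotalEdgeDomaticPartition_bipEdges hdisj hunion hXr hYr x (hdeg x)
  · rintro k ⟨C, hC⟩
    have := two_mul_le_card_of_isTotalEdgeDomaticPartition (card_pos.mp (by lia)) hC
    lia
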